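/- Let λ = (λ_1,…,λ_n) be a vector of positive integers, L = lcm(λ_1,…,λ_n), ω_i = L/λ_i, and let Γ = { α ∈ ℕ^n | ω·α ≥ L } be the exponent set of I(λ). The following are equivalent: (a) I(λ) is normal; (b) whenever α ∈ ℕ^n and p is a positive integer with ω·α ≥ pL, there exist β_1, …, β_p ∈ Γ with α = β_1 + ⋯ + β_p; (c) for all integers p with 1 ≤ p < n and all α = (a_1,…,a_n) ∈ ℕ^n with a_i < λ_i for every i and ω·α ≥ pL, there exist β_1, …, β_p ∈ Γ with α = β_1 + ⋯ + β_p. -/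

import Mathlib

/-- `x` is integral over the ideal `I`: there are `m ≥ 1` and `a j ∈ I ^ j` (`j = 1, …, m`)
with `x ^ m + a 1 * x ^ (m - 1) + ⋯ + a m = 0`. -/
def IdealIntegral {R : Type*} [CommRing R] (I : Ideal R) (x : R) : Prop :=
  ∃ m : ℕ, 0 < m ∧ ∃ a : ℕ → R, (∀ j ∈ Finset.Icc 1 m, a j ∈ I ^ j) ∧
    x ^ m + ∑ j ∈ Finset.Icc 1 m, a j * x ^ (m - j) = 0

open MvPolynomial

/-- The ideal of polynomials all of whose monomials have `w`-weight at least `s`. -/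
def weightIdeal {σ : Type*} (R : Type*) [CommRing R] (w : σ → ℕ) (s : ℕ) :
    Ideal (MvPolynomial σ R) where
  carrier := {f | (s : ℕ∞) ≤ (f : MvPowerSeries σ R).weightedOrder w}
  add_mem' {f g} hf hg := by
    simp only [Set.mem_ofPred_eq, coe_add] at *
    exact (le_min hf hg).trans (MvPowerSeries.min_weightedOrder_le_add w)
  zero_mem' := by simp
  smul_mem' f g hg := by
    simp only [Set.mem_ofPred_eq, smul_eq_mul, coe_mul] at *
    exact (hg.trans le_add_self).trans (MvPowerSeries.le_weightedOrder_mul w)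

section weightIdeal

variable {σ R : Type*} [CommRing R] {w : σ → ℕ} {s t : ℕ}

theorem mem_weightIdeal {f : MvPolynomial σ R} :
    f ∈ weightIdeal R w s ↔ (s : ℕ∞) ≤ (f : MvPowerSeries σ R).weightedOrder w :=
  Iff.rfl

theorem mem_weightIdeal_iff_support {f : MvPolynomial σ R} :
    f ∈ weightIdeal R w s ↔ ∀ d ∈ f.support, s ≤ Finsupp.weight w d := by
  rw [mem_weightIdeal]
  refine ⟨fun h d hd => ?_, fun h => MvPowerSeries.nat_le_weightedOrder w fun d hd => ?_⟩
  · have hd' : MvPowerSeries.coeff d (f : MvPowerSeries σ R) ≠ 0 := by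
      simpa [coeff_coe] using hd
    exact_mod_cast h.trans (MvPowerSeries.weightedOrder_le w hd')
  · by_contra hne
    rw [coeff_coe, ← ne_eq, ← mem_support_iff] at hne
    exact hd.not_ge (h d hne)

theorem monomial_mem_weightIdeal {d : σ →₀ ℕ} (hd : s ≤ Finsupp.weight w d) (a : R) :
    monomial d a ∈ weightIdeal R w s :=
  mem_weightIdeal_iff_support.2 fun e he => by
    rwa [Finset.mem_singleton.1 (support_monomial_subset he)]

theorem weightIdeal_mul_le :
    weightIdeal R w s * weightIdeal R w t ≤ weightIdeal R w (s + t) :=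
  Ideal.mul_le.2 fun f hf g hg => by
    rw [mem_weightIdeal] at *
    rw [coe_mul, Nat.cast_add]
    exact (add_le_add hf hg).trans (MvPowerSeries.le_weightedOrder_mul w)

theorem weightIdeal_pow_le (j : ℕ) :
    weightIdeal R w s ^ j ≤ weightIdeal R w (j * s) := by
  induction j with
  | zero => exact fun f _ => by simp [mem_weightIdeal]
  | succ j ih =>
    rw [pow_succ, Nat.succ_mul]
    exact (Ideal.mul_mono_left ih).trans weightIdeal_mul_le

/-- The ideals `weightIdeal R w s` are integrally closed. -/
theorem IdealIntegral.mem_weightIdeal [IsDomain R] {I : Ideal (MvPolynomial σ R)}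
    (hI : I ≤ weightIdeal R w s) {x : MvPolynomial σ R} (hx : IdealIntegral I x) :
    x ∈ weightIdeal R w s := by
  obtain ⟨m, hm, a, ha, heq⟩ := hx
  by_contra hlt
  rw [_root_.mem_weightIdeal, not_le] at hlt
  have hpow (j : ℕ) : ((x ^ j : MvPolynomial σ R) : MvPowerSeries σ R).weightedOrder w =
      j * (x : MvPowerSeries σ R).weightedOrder w := by
    induction j with
    | zero => simp
    | succ j ih =>
      rw [pow_succ, coe_mul, MvPowerSeries.weightedOrder_mul, ih, Nat.cast_succ, add_mul, one_mul]
  obtain ⟨v, hv⟩ := ENat.ne_top_iff_exists.1 hlt.ne_top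
  rw [← hv, Nat.cast_lt] at hlt
  have hmem : x ^ m ∈ weightIdeal R w (m * v + 1) := by
    rw [eq_neg_of_add_eq_zero_left heq]
    refine neg_mem (sum_mem fun j hj => ?_)
    obtain ⟨hj1, hjm⟩ := Finset.mem_Icc.1 hj
    have haj := weightIdeal_pow_le j (Ideal.pow_right_mono hI j (ha j hj))
    have hxj : x ^ (m - j) ∈ weightIdeal R w ((m - j) * v) := by
      rw [_root_.mem_weightIdeal, hpow, ← hv]
      push_cast
      rfl
    have hprod := weightIdeal_mul_le (Ideal.mul_mem_mul haj hxj)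
    rw [_root_.mem_weightIdeal] at hprod ⊢
    refine (Nat.cast_le.2 ?_).trans hprod
    obtain ⟨k, rfl⟩ := Nat.exists_eq_add_of_le hjm
    rw [Nat.add_sub_cancel_left]
    nlinarith
  rw [_root_.mem_weightIdeal, hpow, ← hv] at hmem
  norm_cast at hmem
  omega

end weightIdeal

/-- `α` is a sum of `p` elements of `Γ`. -/
def IsSumOf {M : Type*} [AddCommMonoid M] (Γ : Set M) (p : ℕ) (α : M) : Prop :=
  ∃ β : Fin p → M, (∀ j, β j ∈ Γ) ∧ α = ∑ j, β j

section IsSumOf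

variable {M : Type*} [AddCommMonoid M] {Γ : Set M} {p : ℕ} {α : M}

theorem isSumOf_zero : IsSumOf Γ 0 α ↔ α = 0 := by
  simp [IsSumOf]

theorem isSumOf_one : IsSumOf Γ 1 α ↔ α ∈ Γ :=
  ⟨by rintro ⟨β, hβ, rfl⟩; simpa using hβ 0, fun h => ⟨fun _ => α, fun _ => h, by simp⟩⟩

theorem isSumOf_succ : IsSumOf Γ (p + 1) α ↔ ∃ β ∈ Γ, ∃ δ, IsSumOf Γ p δ ∧ α = β + δ := by
  constructor
  · rintro ⟨β, hβ, rfl⟩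
    exact ⟨β 0, hβ 0, _, ⟨fun j => β j.succ, fun j => hβ _, rfl⟩, Fin.sum_univ_succ β⟩
  · rintro ⟨β, hβ, _, ⟨δ, hδ, rfl⟩, rfl⟩
    refine ⟨Fin.cons β δ, Fin.cases ?_ ?_, ?_⟩ <;> simp [hβ, hδ, Fin.sum_univ_succ]

theorem IsSumOf.of_le {M : Type*} [AddCommMonoid M] [PartialOrder M] [CanonicallyOrderedAdd M]
    {Γ : Set M} (hΓ : IsUpperSet Γ) {p : ℕ} (hp : 0 < p) {α γ : M} (h : IsSumOf Γ p α)
    (hle : α ≤ γ) : IsSumOf Γ p γ := by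
  obtain ⟨p, rfl⟩ := Nat.exists_eq_succ_of_ne_zero hp.ne'
  obtain ⟨β, hβ, δ, hδ, rfl⟩ := isSumOf_succ.1 h
  obtain ⟨ε, rfl⟩ := exists_add_of_le hle
  exact isSumOf_succ.2 ⟨β + ε, hΓ le_self_add hβ, δ, hδ, add_right_comm _ _ _⟩

end IsSumOf

/-- The `p`-th power of a monomial ideal is generated by the monomials whose exponents are sums of
`p` exponents of generators. -/
theorem span_monomial_pow {σ R : Type*} [CommRing R] (Γ : Set (σ →₀ ℕ)) (p : ℕ) :
    Ideal.span ((fun d => monomial d (1 : R)) '' Γ) ^ p =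
      Ideal.span ((fun d => monomial d (1 : R)) '' {α | IsSumOf Γ p α}) := by
  induction p with
  | zero => simp [isSumOf_zero, Ideal.one_eq_top]
  | succ p ih =>
    rw [pow_succ', ih, Ideal.span_mul_span']
    congr 1
    ext f
    simp only [Set.mem_mul, Set.mem_image, Set.mem_ofPred_eq, isSumOf_succ]
    constructor
    · rintro ⟨_, ⟨β, hβ, rfl⟩, _, ⟨δ, hδ, rfl⟩, rfl⟩
      exact ⟨_, ⟨β, hβ, δ, hδ, rfl⟩, by simp [monomial_mul]⟩
    · rintro ⟨_, ⟨β, hβ, δ, hδ, rfl⟩, rfl⟩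
      exact ⟨_, ⟨β, hβ, rfl⟩, _, ⟨δ, hδ, rfl⟩, by simp [monomial_mul]⟩

theorem mem_span_monomial_pow {σ R : Type*} [CommRing R] {Γ : Set (σ →₀ ℕ)} (hΓ : IsUpperSet Γ)
    {p : ℕ} (hp : 0 < p) {f : MvPolynomial σ R} :
    f ∈ Ideal.span ((fun d => monomial d (1 : R)) '' Γ) ^ p ↔
      ∀ d ∈ f.support, IsSumOf Γ p d := by
  rw [span_monomial_pow, mem_ideal_span_monomial_image]
  exact forall₂_congr fun d _ =>
    ⟨fun ⟨e, he, hle⟩ => IsSumOf.of_le hΓ hp he hle, fun h => ⟨d, h, le_rfl⟩⟩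

theorem Finsupp.weight_eq_sum_mul {σ : Type*} [Fintype σ] (w : σ → ℕ) (d : σ →₀ ℕ) :
    Finsupp.weight w d = ∑ i, w i * d i := by
  simp [Finsupp.weight_apply, Finsupp.sum_fintype, mul_comm]

theorem isUpperSet_le_weight {σ : Type*} (w : σ → ℕ) (s : ℕ) :
    IsUpperSet {d : σ →₀ ℕ | s ≤ Finsupp.weight w d} := by
  rintro d _ hle hd
  obtain ⟨e, rfl⟩ := exists_add_of_le hle
  simp only [Set.mem_ofPred_eq, map_add] at *
  omega

theorem weightIdeal_eq_span {σ R : Type*} [CommRing R] (w : σ → ℕ) (s : ℕ) :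
    weightIdeal R w s =
      Ideal.span ((fun d => monomial d (1 : R)) '' {d | s ≤ Finsupp.weight w d}) := by
  ext f
  rw [mem_weightIdeal_iff_support, ← pow_one (Ideal.span _),
    mem_span_monomial_pow (isUpperSet_le_weight w s) one_pos]
  simp only [isSumOf_one, Set.mem_ofPred_eq]

theorem IdealIntegral.of_pow_mem {R : Type*} [CommRing R] {I : Ideal R} {x : R} {m : ℕ}
    (hm : 0 < m) (h : x ^ m ∈ I ^ m) : IdealIntegral I x := by
  refine ⟨m, hm, fun j => if j = m then -x ^ m else 0, fun j _ => ?_, ?_⟩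
  · dsimp only
    split_ifs with hj
    · rw [hj]
      exact neg_mem h
    · exact zero_mem _
  · rw [Finset.sum_eq_single_of_mem m (by simp; omega) fun j _ hj => by simp [hj]]
    simp

theorem IdealIntegral.mono {R : Type*} [CommRing R] {I I' : Ideal R} (h : I ≤ I') {x : R}
    (hx : IdealIntegral I x) : IdealIntegral I' x := by
  obtain ⟨m, hm, a, ha, heq⟩ := hx
  exact ⟨m, hm, a, fun j hj => Ideal.pow_right_mono h j (ha j hj), heq⟩

/-- If `ω i * lam i = L` for all `i`, monomials of `ω`-weight at least `p * L` are integral over the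
`p`-th power of the ideal generated by the `X i ^ lam i`. -/
theorem idealIntegral_monomial {σ R : Type*} [Fintype σ] [CommRing R] {lam ω : σ → ℕ} {L : ℕ}
    (hL : 0 < L) (hω : ∀ i, ω i * lam i = L) {p : ℕ} {d : σ →₀ ℕ}
    (hd : p * L ≤ Finsupp.weight ω d) :
    IdealIntegral (Ideal.span (Set.range fun i => (X i : MvPolynomial σ R) ^ lam i) ^ p)
      (monomial d 1) := by
  refine IdealIntegral.of_pow_mem hL ?_
  rw [← pow_mul]
  refine Ideal.pow_le_pow_right hd ?_
  have hmon : (monomial d (1 : R)) ^ L = ∏ i, (X i ^ lam i) ^ (ω i * d i) := by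
    rw [monomial_eq, C_1, one_mul, Finsupp.prod_fintype _ _ (by simp), ← Finset.prod_pow]
    refine Finset.prod_congr rfl fun i _ => ?_
    rw [← pow_mul, ← pow_mul, ← hω i]
    ring_nf
  rw [hmon, Finsupp.weight_eq_sum_mul, ← Finset.prod_pow_eq_pow_sum]
  exact Ideal.prod_mem_prod fun i _ =>
    Ideal.pow_mem_pow (Ideal.subset_span (Set.mem_range_self i)) _

/-- Decomposability of all exponent vectors follows from that of the small ones. -/
theorem isSumOf_of_forall_lt {σ : Type*} [Fintype σ] [Nonempty σ] {lam ω : σ → ℕ} {L : ℕ}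
    (hL : 0 < L) (hω : ∀ i, ω i * lam i = L)
    (h : ∀ p, 1 ≤ p → p < Fintype.card σ → ∀ α : σ →₀ ℕ, (∀ i, α i < lam i) →
      p * L ≤ Finsupp.weight ω α → IsSumOf {d | L ≤ Finsupp.weight ω d} p α)
    (α : σ →₀ ℕ) (p : ℕ) (hp : 0 < p) (hα : p * L ≤ Finsupp.weight ω α) :
    IsSumOf {d | L ≤ Finsupp.weight ω d} p α := by
  induction p, hp using Nat.le_induction generalizing α with
  | base => exact isSumOf_one.2 (by simpa using hα)
  | succ p hp ih =>
    by_cases hlt : ∀ i, α i < lam i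
    · refine h _ (by omega) ?_ α hlt hα
      have hw : Finsupp.weight ω α < Fintype.card σ * L := by
        rw [Finsupp.weight_eq_sum_mul]
        rw [← smul_eq_mul (Fintype.card σ), ← Finset.card_univ, ← Finset.sum_const]
        refine Finset.sum_lt_sum_of_nonempty Finset.univ_nonempty fun i _ => ?_
        rw [← hω i]
        have hi : 0 < ω i := Nat.pos_of_mul_pos_right (hω i ▸ hL)
        exact Nat.mul_lt_mul_of_pos_left (hlt i) hi
      exact lt_of_mul_lt_mul_right (hα.trans_lt hw) (Nat.zero_le L)
    · push Not at hlt
      obtain ⟨i, hi⟩ := hlt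
      obtain ⟨δ, rfl⟩ := exists_add_of_le (Finsupp.single_le_iff.2 hi)
      have hs : Finsupp.weight ω (Finsupp.single i (lam i)) = L := by
        simp [Finsupp.weight_single, ← hω i, mul_comm]
      rw [map_add, hs] at hα
      exact isSumOf_succ.2 ⟨_, hs.ge, δ, ih δ (by linarith), rfl⟩

/-- With `J(λ) = (x_1^{λ_1}, …, x_n^{λ_n})`, `I(λ) = \overline{J(λ)}`,
`L = lcm(λ)`, `ω_i = L/λ_i` and `Γ = {α ∈ ℕ^n | ω·α ≥ L}` the exponent set of `I(λ)`,
the following are equivalent: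
(a) `I(λ)` is normal;
(b) whenever `α ∈ ℕ^n`, `p ≥ 1` and `ω·α ≥ pL`, then `α = β_1 + ⋯ + β_p` with all `β_j ∈ Γ`;
(c) for all `1 ≤ p < n` and `α ∈ ℕ^n` with `a_i < λ_i` for all `i` and `ω·α ≥ pL`,
    `α = β_1 + ⋯ + β_p` with all `β_j ∈ Γ`. -/
theorem I_lambda_normal_iff_exponent_conditions
    {K : Type*} [Field K] {n : ℕ} (hn : 0 < n)
    (lam : Fin n → ℕ) (hlam : ∀ i, 0 < lam i)
    (L : ℕ) (hL : L = Finset.univ.lcm lam)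
    (ω : Fin n → ℕ) (hω : ∀ i, ω i = L / lam i)
    (J Ilam : Ideal (MvPolynomial (Fin n) K))
    (hJ : J = Ideal.span (Set.range fun i => (MvPolynomial.X i : MvPolynomial (Fin n) K) ^ lam i))
    -- `I(λ)` is the integral closure of `J(λ)`
    (hIlam : ∀ x : MvPolynomial (Fin n) K, x ∈ Ilam ↔ IdealIntegral J x)
    (Γ : Set (Fin n →₀ ℕ))
    (hΓ : Γ = {α : Fin n →₀ ℕ | L ≤ ∑ i, ω i * α i}) :
    -- (a) ↔ (b)
    ((∀ k : ℕ, 0 < k → ∀ x : MvPolynomial (Fin n) K,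
        IdealIntegral (Ilam ^ k) x → x ∈ Ilam ^ k) ↔
      (∀ (α : Fin n →₀ ℕ) (p : ℕ), 0 < p → p * L ≤ ∑ i, ω i * α i →
        ∃ β : Fin p → (Fin n →₀ ℕ), (∀ j, β j ∈ Γ) ∧ α = ∑ j, β j)) ∧
    -- (a) ↔ (c)
    ((∀ k : ℕ, 0 < k → ∀ x : MvPolynomial (Fin n) K,
        IdealIntegral (Ilam ^ k) x → x ∈ Ilam ^ k) ↔
      (∀ p : ℕ, 1 ≤ p → p < n → ∀ α : Fin n →₀ ℕ, (∀ i, α i < lam i) →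
        p * L ≤ ∑ i, ω i * α i →
        ∃ β : Fin p → (Fin n →₀ ℕ), (∀ j, β j ∈ Γ) ∧ α = ∑ j, β j)) := by
  have hLpos : 0 < L := by
    rw [hL, Nat.pos_iff_ne_zero, ne_eq, Finset.lcm_eq_zero_iff]
    simpa using fun i => (hlam i).ne'
  have hωL (i : Fin n) : ω i * lam i = L := by
    rw [hω, Nat.div_mul_cancel (hL ▸ Finset.dvd_lcm (Finset.mem_univ i))]
  have hJle : J ≤ weightIdeal K ω L := by
    rw [hJ, Ideal.span_le]
    rintro _ ⟨i, rfl⟩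
    dsimp only
    rw [X_pow_eq_monomial]
    refine monomial_mem_weightIdeal ?_ 1
    simp [Finsupp.weight_single, ← hωL i, mul_comm]
  have hI : Ilam = weightIdeal K ω L := by
    refine le_antisymm (fun x hx => ((hIlam x).1 hx).mem_weightIdeal hJle) ?_
    rw [weightIdeal_eq_span, Ideal.span_le]
    rintro _ ⟨d, hd, rfl⟩
    have h := idealIntegral_monomial (R := K) hLpos hωL (p := 1) (d := d) (by simpa using hd)
    rw [pow_one, ← hJ] at h
    exact (hIlam _).2 h
  have hJI : J ≤ Ilam := hI ▸ hJle
  simp only [← Finsupp.weight_eq_sum_mul] at hΓ ⊢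
  have hmem {p : ℕ} (hp : 0 < p) (x : MvPolynomial (Fin n) K) :
      x ∈ Ilam ^ p ↔ ∀ d ∈ x.support, IsSumOf Γ p d := by
    rw [hI, weightIdeal_eq_span, hΓ]
    exact mem_span_monomial_pow (isUpperSet_le_weight ω L) hp
  have hab : (∀ k : ℕ, 0 < k → ∀ x : MvPolynomial (Fin n) K,
      IdealIntegral (Ilam ^ k) x → x ∈ Ilam ^ k) ↔
      ∀ (α : Fin n →₀ ℕ) (p : ℕ), 0 < p → p * L ≤ Finsupp.weight ω α → IsSumOf Γ p α := by
    constructor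
    · intro h α p hp hα
      have hint := idealIntegral_monomial (R := K) hLpos hωL hα
      rw [← hJ] at hint
      exact (hmem hp _).1 (h p hp _ (hint.mono (Ideal.pow_right_mono hJI p))) α (by simp)
    · intro h k hk x hx
      have hx' := hx.mem_weightIdeal (hI ▸ weightIdeal_pow_le k)
      exact (hmem hk x).2 fun d hd => h d k hk (mem_weightIdeal_iff_support.1 hx' d hd)
  have : Nonempty (Fin n) := ⟨⟨0, hn⟩⟩
  refine ⟨hab, hab.trans ⟨fun h p hp _ α _ hα => h α p hp hα, fun h => ?_⟩⟩
  subst hΓ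
  exact isSumOf_of_forall_lt hLpos hωL (by rwa [Fintype.card_fin])
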